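/- Let h be a Hessenberg function for type C_n. For each Hessenberg function h' for type C_n with h'(i) ≤ h(i) for all i, let P_{h'} denote the class of ∏_{i=1}^{n} ∏_{j=h'(i)+1}^{h(i)} α^{C}_{i,j} in R^{C}_{h} (this class equals, up to a nonzero scalar, the Poincaré dual [Hess(N,h')] of the smaller regular nilpotent Hessenberg variety inside Hess(N,h)). Then the family {P_{h'} : h' a Hessenberg function with h' ≤ h pointwise} is linearly independent over ℝ in R^{C}_{h}. -/

import Mathlib

open MvPolynomial

noncomputable section

/-- The variable `x_k` (1-indexed) of `ℝ[x_1,…,x_n]`. -/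
def xv (n : ℕ) (k : ℕ) : MvPolynomial (Fin n) ℝ :=
  if h : 1 ≤ k ∧ k ≤ n then X ⟨k - 1, by omega⟩ else 0

/-- The type `C_n` root label `α^{C}_{i,j}`: `x_i − x_j` for `i+1 ≤ j ≤ n`,
`x_i + x_{2n+1−j}` for `n+1 ≤ j ≤ 2n−i`, and `2x_i` for `j = 2n+1−i`. -/
def alC (n i j : ℕ) : MvPolynomial (Fin n) ℝ :=
  if j ≤ n then xv n i - xv n j
  else if j ≤ 2 * n - i then xv n i + xv n (2 * n + 1 - j)
  else 2 * xv n i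

/-- The polynomial `f^{C}_{i,j} = Σ_{k=1}^{i}(∏_{ℓ=i+1}^{j} α^{C}_{k,ℓ})·x_k`. -/
def fCij (n i j : ℕ) : MvPolynomial (Fin n) ℝ :=
  ∑ k ∈ Finset.Icc 1 i, (∏ ℓ ∈ Finset.Icc (i + 1) j, alC n k ℓ) * xv n k

/-- The ideal `(f^{C}_{1,h(1)}, …, f^{C}_{n,h(n)})`,
so that `R^{C}_h = ℝ[x_1,…,x_n]/ICh n h ≅ H^*(Hess(N,h);ℝ)` in type `C_n`. -/
def ICh (n : ℕ) (h : ℕ → ℕ) : Ideal (MvPolynomial (Fin n) ℝ) :=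
  Ideal.span ((fun i => fCij n i (h i)) '' Set.Icc 1 n)

/-- Hessenberg functions `h'` of type `C_n` with `h' ≤ h` pointwise (normalised by
`h' i = 0` outside `{1,…,n}`): the index set of the Poincaré duals `[Hess(N,h')]`. -/
def HessSubC (n : ℕ) (h : ℕ → ℕ) : Type :=
  {h' : ℕ → ℕ //
    (∀ i ∈ Finset.Icc 1 n, i ≤ h' i ∧ h' i ≤ 2 * n + 1 - i) ∧
    (∀ i ∈ Finset.Icc 1 (n - 1), h' i ≠ 2 * n + 1 - i → h' i ≤ h' (i + 1)) ∧
    (∀ i ∈ Finset.Icc 1 (n - 1), h' i = 2 * n + 1 - i → h' (i + 1) = 2 * n + 1 - (i + 1)) ∧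
    (∀ i, i ∉ Finset.Icc 1 n → h' i = 0) ∧
    (∀ i ∈ Finset.Icc 1 n, h' i ≤ h i)}

/-- The signed variable `y_j`: `x_j` for `j ≤ n` and `-x_{2n+1-j}` for `j > n`. -/
def yv (n j : ℕ) : MvPolynomial (Fin n) ℝ :=
  if j ≤ n then xv n j else -xv n (2 * n + 1 - j)

theorem alC_eq_sub (n k j : ℕ) (hk : 1 ≤ k) (hkn : k ≤ n) (hj : j ≤ 2 * n + 1 - k) :
    alC n k j = xv n k - yv n j := by
  unfold alC yv
  split_ifs with h1 h2
  · rfl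
  · ring
  · obtain rfl : j = 2 * n + 1 - k := by omega
    rw [show 2 * n + 1 - (2 * n + 1 - k) = k by omega]
    ring

section RegularSequence

variable {S : Type*} [CommRing S]

/-- The list is a weakly regular sequence modulo the ideal `J`. -/
def WeaklyRegularMod : Ideal S → List S → Prop
  | _, [] => True
  | J, g :: gs => (∀ u, g * u ∈ J → u ∈ J) ∧ WeaklyRegularMod (J ⊔ Ideal.span {g}) gs

theorem Ideal.mem_sup_span {J : Ideal S} {a u : S} :
    u ∈ J ⊔ Ideal.span {a} ↔ ∃ w, u - a * w ∈ J := by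
  constructor
  · intro hu
    obtain ⟨x, hx, y, hy, rfl⟩ := Submodule.mem_sup.1 hu
    obtain ⟨w, rfl⟩ := Ideal.mem_span_singleton'.1 hy
    exact ⟨w, by convert hx using 1; ring⟩
  · rintro ⟨w, hw⟩
    have := (J ⊔ Ideal.span {a}).add_mem (Ideal.mem_sup_left hw)
      (Ideal.mem_sup_right (Ideal.mul_mem_right w _ (Ideal.mem_span_singleton_self a)))
    convert this using 1
    ring

/-- If `a, g` is weakly regular modulo `J`, then `a` is regular modulo `J + (g)`. -/
theorem regular_sup_of_regular {J : Ideal S} {a g : S} (ha : ∀ u, a * u ∈ J → u ∈ J)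
    (hg : ∀ u, g * u ∈ J ⊔ Ideal.span {a} → u ∈ J ⊔ Ideal.span {a}) :
    ∀ u, a * u ∈ J ⊔ Ideal.span {g} → u ∈ J ⊔ Ideal.span {g} := by
  intro u hu
  obtain ⟨w, hw⟩ := Ideal.mem_sup_span.1 hu
  have h1 : g * w ∈ J ⊔ Ideal.span {a} := by
    refine Ideal.mem_sup_span.2 ⟨u, ?_⟩
    convert J.neg_mem hw using 1
    ring
  obtain ⟨v, hv⟩ := Ideal.mem_sup_span.1 (hg w h1)
  refine Ideal.mem_sup_span.2 ⟨v, ha _ ?_⟩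
  convert J.add_mem hw (J.mul_mem_left g hv) using 1
  ring

theorem WeaklyRegularMod.regular_sup_ofList {a : S} :
    ∀ {gs : List S} {J : Ideal S}, (∀ u, a * u ∈ J → u ∈ J) →
      WeaklyRegularMod (J ⊔ Ideal.span {a}) gs →
      ∀ u, a * u ∈ J ⊔ Ideal.ofList gs → u ∈ J ⊔ Ideal.ofList gs
  | [], J, ha, _ => by simpa using ha
  | g :: gs, J, ha, hgs => by
    have key := WeaklyRegularMod.regular_sup_ofList (gs := gs) (J := J ⊔ Ideal.span {g})
      (regular_sup_of_regular ha hgs.1) (by rw [sup_right_comm]; exact hgs.2)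
    rw [Ideal.ofList_cons, ← sup_assoc]
    exact key

theorem WeaklyRegularMod.mul {a b : S} :
    ∀ {gs : List S} {J : Ideal S}, (∀ u, b * u ∈ J → u ∈ J) →
      WeaklyRegularMod (J ⊔ Ideal.span {a}) gs → WeaklyRegularMod (J ⊔ Ideal.span {b}) gs →
      WeaklyRegularMod (J ⊔ Ideal.span {a * b}) gs
  | [], _, _, _, _ => trivial
  | g :: gs, J, hb, hga, hgb => by
    refine ⟨fun u hu => ?_, ?_⟩
    · obtain ⟨w, hw⟩ := Ideal.mem_sup_span.1 hu
      have h1 : g * u ∈ J ⊔ Ideal.span {b} :=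
        Ideal.mem_sup_span.2 ⟨a * w, by convert hw using 1; ring⟩
      obtain ⟨v, hv⟩ := Ideal.mem_sup_span.1 (hgb.1 u h1)
      have h2 : g * v - a * w ∈ J := by
        apply hb
        convert J.sub_mem hw (J.mul_mem_left g hv) using 1
        ring
      obtain ⟨z, hz⟩ := Ideal.mem_sup_span.1 (hga.1 v (Ideal.mem_sup_span.2 ⟨w, h2⟩))
      refine Ideal.mem_sup_span.2 ⟨z, ?_⟩
      convert J.add_mem hv (J.mul_mem_left b hz) using 1
      ring
    · have key := WeaklyRegularMod.mul (a := a) (b := b) (gs := gs) (J := J ⊔ Ideal.span {g})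
        (regular_sup_of_regular hb hgb.1) (by rw [sup_right_comm]; exact hga.2)
        (by rw [sup_right_comm]; exact hgb.2)
      rw [sup_right_comm]
      exact key

theorem weaklyRegularMod_top : ∀ gs : List S, WeaklyRegularMod (⊤ : Ideal S) gs
  | [] => trivial
  | g :: gs => ⟨fun _ _ => trivial, by rw [top_sup_eq]; exact weaklyRegularMod_top gs⟩

theorem WeaklyRegularMod.prod {J : Ideal S} {gs : List S} (s : Finset ℕ) (a : ℕ → S)
    (ha : ∀ j ∈ s, ∀ u, a j * u ∈ J → u ∈ J)
    (hgs : ∀ j ∈ s, WeaklyRegularMod (J ⊔ Ideal.span {a j}) gs) :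
    WeaklyRegularMod (J ⊔ Ideal.span {∏ j ∈ s, a j}) gs := by
  induction s using Finset.induction_on with
  | empty =>
    rw [Finset.prod_empty, Ideal.span_singleton_one, sup_top_eq]
    exact weaklyRegularMod_top gs
  | insert j s hj ih =>
    rw [Finset.prod_insert hj, mul_comm]
    exact WeaklyRegularMod.mul (ha j (Finset.mem_insert_self j s))
      (ih (fun i hi => ha i (Finset.mem_insert_of_mem hi))
        (fun i hi => hgs i (Finset.mem_insert_of_mem hi)))
      (hgs j (Finset.mem_insert_self j s))

/-- Peeling off regular factors `a_d, a_{d-1}, …, a_s` one at a time from a relation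
modulo `L + (a_s ⋯ a_d)`. -/
theorem eq_zero_of_sum_prod_mul_mem {L : Ideal S} (a Q : ℕ → S) (s d : ℕ)
    (ha : ∀ j ∈ Finset.Icc s d, ∀ u, a j * u ∈ L → u ∈ L)
    (hQ : ∀ j ∈ Finset.Icc s d, Q j ∈ L ⊔ Ideal.span {a j} → Q j = 0)
    (hmem : ∑ j ∈ Finset.Icc s d, (∏ l ∈ Finset.Icc (j + 1) d, a l) * Q j ∈
      L ⊔ Ideal.span {∏ l ∈ Finset.Icc s d, a l}) :
    ∀ j ∈ Finset.Icc s d, Q j = 0 := by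
  rcases Nat.lt_or_ge d s with hlt | hle
  · simp [Finset.Icc_eq_empty_of_lt hlt]
  induction d, hle using Nat.le_induction with
  | base =>
    have hs : s ∈ Finset.Icc s s := by simp
    intro j hj
    obtain rfl : j = s := by simpa using hj
    exact hQ j hs (by simpa using hmem)
  | succ d hsd ih =>
    have hd : d + 1 ∈ Finset.Icc s (d + 1) := by simp; omega
    have hsub : Finset.Icc s d ⊆ Finset.Icc s (d + 1) :=
      Finset.Icc_subset_Icc_right (Nat.le_succ d)
    have hsum : ∑ j ∈ Finset.Icc s (d + 1), (∏ l ∈ Finset.Icc (j + 1) (d + 1), a l) * Q j =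
        a (d + 1) * ∑ j ∈ Finset.Icc s d, (∏ l ∈ Finset.Icc (j + 1) d, a l) * Q j
          + Q (d + 1) := by
      rw [Finset.sum_Icc_succ_top (by omega), Finset.mul_sum]
      congr 1
      · refine Finset.sum_congr rfl fun j hj => ?_
        rw [Finset.prod_Icc_succ_top (by have := Finset.mem_Icc.1 hj; omega)]
        ring
      · simp
    rw [hsum, Finset.prod_Icc_succ_top (by omega)] at hmem
    obtain ⟨w, hw⟩ := Ideal.mem_sup_span.1 hmem
    have hQd : Q (d + 1) = 0 := by
      apply hQ _ hd
      refine Ideal.mem_sup_span.2 ⟨(∏ l ∈ Finset.Icc s d, a l) * w -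
        ∑ j ∈ Finset.Icc s d, (∏ l ∈ Finset.Icc (j + 1) d, a l) * Q j, ?_⟩
      convert hw using 1
      ring
    have hrest := ih (fun j hj => ha j (hsub hj)) (fun j hj => hQ j (hsub hj)) (by
      refine Ideal.mem_sup_span.2 ⟨w, ha _ hd _ ?_⟩
      rw [hQd] at hw
      convert hw using 1
      ring)
    intro j hj
    rcases Nat.lt_or_ge d j with hdj | hjd
    · obtain rfl : j = d + 1 := by have := Finset.mem_Icc.1 hj; omega
      exact hQd
    · exact hrest j (by have := Finset.mem_Icc.1 hj; simp; omega)

end RegularSequence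

/-- The linear factors of `f_{i,j}` after specialising `x_1, …, x_{i-1}`. -/
def linFactor (n i j : ℕ) : MvPolynomial (Fin n) ℝ :=
  if j = i then xv n i else alC n i j

/-- `φ` fixes `x_k` for `k > r` and sends each `x_k` with `k ≤ r` to `0` or to some `y_t`
with `r < t ≤ min (2n - r) (h (r + 1))`. -/
def IsSpecialization (n : ℕ) (h : ℕ → ℕ) (r : ℕ)
    (φ : MvPolynomial (Fin n) ℝ →ₐ[ℝ] MvPolynomial (Fin n) ℝ) : Prop :=
  (∀ k, r < k → φ (xv n k) = xv n k) ∧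
  ∀ k, k ≤ r → φ (xv n k) = 0 ∨
    ∃ t, r < t ∧ t ≤ 2 * n - r ∧ (r < n → t ≤ h (r + 1)) ∧ φ (xv n k) = yv n t

theorem xv_succ (n : ℕ) (i : Fin n) : xv n (i + 1) = X i := by
  unfold xv
  rw [dif_pos ⟨by omega, by omega⟩]
  rfl

theorem algHom_ext_xv {n : ℕ} {A : Type*} [CommRing A] [Algebra ℝ A]
    {φ ψ : MvPolynomial (Fin n) ℝ →ₐ[ℝ] A} (hφ : ∀ k, φ (xv n k) = ψ (xv n k)) : φ = ψ := by
  apply MvPolynomial.algHom_ext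
  intro i
  rw [← xv_succ]
  exact hφ _

theorem yv_reflect (n j : ℕ) (hj : 1 ≤ j) (hj2 : j ≤ 2 * n) :
    yv n (2 * n + 1 - j) = -yv n j := by
  unfold yv
  split_ifs with h1 h2 h2
  · omega
  · rw [neg_neg]
  · rw [show 2 * n + 1 - (2 * n + 1 - j) = j by omega]
  · omega

namespace IsSpecialization

variable {n : ℕ} {h : ℕ → ℕ} {r : ℕ} {φ : MvPolynomial (Fin n) ℝ →ₐ[ℝ] MvPolynomial (Fin n) ℝ}

theorem map_yv (hφ : IsSpecialization n h r φ) {t : ℕ} (ht : r < t) (ht2 : t ≤ 2 * n - r) :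
    φ (yv n t) = yv n t := by
  unfold yv
  split_ifs
  · exact hφ.1 t ht
  · rw [map_neg, hφ.1 _ (by omega)]

theorem map_map (hφ : IsSpecialization n h r φ) (p : MvPolynomial (Fin n) ℝ) :
    φ (φ p) = φ p := by
  have : φ.comp φ = φ := by
    apply algHom_ext_xv
    intro k
    rw [AlgHom.comp_apply]
    rcases Nat.lt_or_ge r k with hk | hk
    · rw [hφ.1 k hk, hφ.1 k hk]
    · rcases hφ.2 k hk with h0 | ⟨t, h1, h2, -, h3⟩
      · rw [h0, map_zero]
      · rw [h3, hφ.map_yv h1 h2]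
  exact DFunLike.congr_fun this p

theorem map_linFactor (hφ : IsSpecialization n h r φ) (hr : r < n) {j : ℕ} (hj : r + 1 ≤ j)
    (hj2 : j ≤ 2 * n - r) : φ (linFactor n (r + 1) j) = linFactor n (r + 1) j := by
  unfold linFactor
  split_ifs
  · exact hφ.1 _ (by omega)
  · rw [alC_eq_sub n (r + 1) j (by omega) (by omega) (by omega), map_sub, hφ.1 _ (by omega),
      hφ.map_yv (by omega) hj2]

end IsSpecialization

theorem linFactor_ne_zero {n i j : ℕ} (hi : 1 ≤ i) (hin : i ≤ n) (hij : i ≤ j)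
    (hj : j ≤ 2 * n + 1 - i) : linFactor n i j ≠ 0 := by
  intro h0
  unfold linFactor at h0
  split_ifs at h0 with hji
  · rw [xv, dif_pos ⟨hi, hin⟩] at h0
    exact X_ne_zero _ h0
  · rw [alC_eq_sub n i j hi hin hj] at h0
    by_cases hjn : j ≤ n
    · rw [yv, if_pos hjn, xv, dif_pos ⟨hi, hin⟩, xv, dif_pos ⟨by omega, hjn⟩, sub_eq_zero] at h0
      have := congrArg Fin.val (X_injective h0)
      simp only at this
      omega
    · rw [yv, if_neg hjn, xv, dif_pos ⟨hi, hin⟩, xv, dif_pos ⟨by omega, by omega⟩] at h0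
      have := congrArg (eval fun _ => (1 : ℝ)) h0
      norm_num at this

/-- The substitution `x_i ↦ z`. -/
def substVar (n i : ℕ) (z : MvPolynomial (Fin n) ℝ) :
    MvPolynomial (Fin n) ℝ →ₐ[ℝ] MvPolynomial (Fin n) ℝ :=
  aeval fun s : Fin n => if (s : ℕ) + 1 = i then z else X s

theorem substVar_self {n i : ℕ} (hi : 1 ≤ i) (hin : i ≤ n) (z : MvPolynomial (Fin n) ℝ) :
    substVar n i z (xv n i) = z := by
  rw [xv, dif_pos ⟨hi, hin⟩, substVar, aeval_X, if_pos (by simp only; omega)]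

theorem substVar_of_ne {n i k : ℕ} (hk : k ≠ i) (z : MvPolynomial (Fin n) ℝ) :
    substVar n i z (xv n k) = xv n k := by
  unfold xv
  split_ifs with hkn
  · rw [substVar, aeval_X, if_neg (by simp only; omega)]
  · exact map_zero _

theorem sub_substVar_mem {n i : ℕ} (hi : 1 ≤ i) (hin : i ≤ n) (z p : MvPolynomial (Fin n) ℝ) :
    p - substVar n i z p ∈ Ideal.span {xv n i - z} := by
  have : (Ideal.Quotient.mkₐ ℝ (Ideal.span {xv n i - z})).comp (substVar n i z) =
      Ideal.Quotient.mkₐ ℝ (Ideal.span {xv n i - z}) := by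
    apply algHom_ext_xv
    intro k
    rw [AlgHom.comp_apply]
    by_cases hk : k = i
    · subst hk
      rw [substVar_self hi hin]
      refine (Ideal.Quotient.eq.2 (Ideal.mem_span_singleton_self _)).symm
    · rw [substVar_of_ne hk]
  exact Ideal.Quotient.eq.1 (DFunLike.congr_fun this p).symm

theorem IsSpecialization.exists_succ {n : ℕ} {h : ℕ → ℕ}
    (hh1 : ∀ i ∈ Finset.Icc 1 n, i ≤ h i ∧ h i ≤ 2 * n + 1 - i)
    (hh2 : ∀ i ∈ Finset.Icc 1 (n - 1), h i ≠ 2 * n + 1 - i → h i ≤ h (i + 1))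
    (hh3 : ∀ i ∈ Finset.Icc 1 (n - 1), h i = 2 * n + 1 - i → h (i + 1) = 2 * n + 1 - (i + 1))
    {r : ℕ} {φ : MvPolynomial (Fin n) ℝ →ₐ[ℝ] MvPolynomial (Fin n) ℝ}
    (hφ : IsSpecialization n h r φ) (hr : r < n) {j : ℕ} (hj : j ∈ Finset.Icc (r + 1) (h (r + 1))) :
    ∃ φ', IsSpecialization n h (r + 1) φ' ∧
      RingHom.ker φ' = RingHom.ker φ ⊔ Ideal.span {linFactor n (r + 1) j} := by
  obtain ⟨hj1, hj2⟩ := Finset.mem_Icc.1 hj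
  obtain ⟨-, hb⟩ := hh1 (r + 1) (by simp; omega)
  have hnext : ∀ t, t ≤ h (r + 1) → t ≠ 2 * n - r → r + 1 < n → t ≤ h (r + 1 + 1) := by
    intro t ht htn hrn
    have hmem : r + 1 ∈ Finset.Icc 1 (n - 1) := by simp; omega
    by_cases he : h (r + 1) = 2 * n + 1 - (r + 1)
    · have := hh3 _ hmem he
      omega
    · have := hh2 _ hmem he
      omega
  obtain ⟨z, hzφ, hspan, hz⟩ : ∃ z, φ z = z ∧
      Ideal.span {linFactor n (r + 1) j} = Ideal.span {xv n (r + 1) - z} ∧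
      (z = 0 ∨ z = yv n j ∧ r + 1 < j ∧ j < 2 * n - r) := by
    by_cases hjr : j = r + 1
    · exact ⟨0, map_zero _, by rw [linFactor, if_pos hjr, sub_zero], Or.inl rfl⟩
    by_cases hjn : j = 2 * n - r
    · refine ⟨0, map_zero _, ?_, Or.inl rfl⟩
      rw [linFactor, if_neg hjr, sub_zero, alC, if_neg (by omega), if_neg (by omega)]
      apply Ideal.span_singleton_mul_left_unit
      have : IsUnit (C (2 : ℝ) : MvPolynomial (Fin n) ℝ) :=
        (isUnit_iff_ne_zero.2 two_ne_zero).map C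
      rwa [show (C (2 : ℝ) : MvPolynomial (Fin n) ℝ) = 2 from map_ofNat C 2] at this
    · refine ⟨yv n j, hφ.map_yv (by omega) (by omega), ?_, Or.inr ⟨rfl, by omega, by omega⟩⟩
      rw [linFactor, if_neg hjr, alC_eq_sub n (r + 1) j (by omega) (by omega) (by omega)]
  have hψy : ∀ t, r + 1 < t → t < 2 * n - r → substVar n (r + 1) z (yv n t) = yv n t := by
    intro t ht ht2
    unfold yv
    split_ifs
    · exact substVar_of_ne (by omega) z
    · rw [map_neg, substVar_of_ne (by omega) z]
  have hψz : substVar n (r + 1) z z = z := by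
    rcases hz with rfl | ⟨rfl, h1, h2⟩
    · exact map_zero _
    · exact hψy j h1 h2
  have hψx : substVar n (r + 1) z (xv n (r + 1)) = z := substVar_self (by omega) (by omega) z
  have hfix : φ (xv n (r + 1) - z) = xv n (r + 1) - z := by
    rw [map_sub, hzφ, hφ.1 _ (by omega)]
  refine ⟨(substVar n (r + 1) z).comp φ, ⟨fun k hk => ?_, fun k hk => ?_⟩, ?_⟩
  · rw [AlgHom.comp_apply, hφ.1 k (by omega), substVar_of_ne (by omega) z]
  · have hzcase : z = 0 ∨ ∃ t, r + 1 < t ∧ t ≤ 2 * n - (r + 1) ∧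
        (r + 1 < n → t ≤ h (r + 1 + 1)) ∧ z = yv n t := by
      rcases hz with h0 | ⟨h0, h1, h2⟩
      · exact Or.inl h0
      · exact Or.inr ⟨j, h1, by omega, hnext j hj2 (by omega), h0⟩
    rw [AlgHom.comp_apply]
    rcases Nat.lt_or_ge r k with hk' | hk'
    · obtain rfl : k = r + 1 := by omega
      rwa [hφ.1 _ (by omega), hψx]
    · rcases hφ.2 k hk' with h0 | ⟨t, h1, h2, h3, h4⟩
      · exact Or.inl (by rw [h0, map_zero])
      rw [h4]
      by_cases ht : t = r + 1
      · rw [ht, yv, if_pos (by omega), hψx]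
        exact hzcase
      by_cases ht' : t = 2 * n - r
      · have hy : substVar n (r + 1) z (yv n t) = -z := by
          rw [ht', yv, if_neg (by omega), map_neg,
            show 2 * n + 1 - (2 * n - r) = r + 1 by omega, hψx]
        rw [hy]
        rcases hz with rfl | ⟨rfl, h5, h6⟩
        · exact Or.inl neg_zero
        · refine Or.inr ⟨2 * n + 1 - j, by omega, by omega, hnext _ ?_ (by omega),
            (yv_reflect n j (by omega) (by omega)).symm⟩
          have := h3 hr
          omega
      · exact Or.inr ⟨t, by omega, by omega, hnext t (h3 hr) ht', hψy t (by omega) (by omega)⟩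
  · rw [hspan]
    apply le_antisymm
    · intro p hp
      rw [RingHom.mem_ker, AlgHom.comp_apply] at hp
      have hmem := sub_substVar_mem (i := r + 1) (by omega) (by omega) z (φ p)
      rw [hp, sub_zero] at hmem
      obtain ⟨q, hq⟩ := Ideal.mem_span_singleton.1 hmem
      refine Ideal.mem_sup_span.2 ⟨q, ?_⟩
      rw [RingHom.mem_ker, map_sub, ← hq, hφ.map_map, sub_self]
    · refine sup_le (fun p hp => ?_) ?_
      · rw [RingHom.mem_ker] at hp ⊢
        rw [AlgHom.comp_apply, hp, map_zero]
      · rw [Ideal.span_singleton_le_iff_mem, RingHom.mem_ker, AlgHom.comp_apply, hfix, map_sub,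
          hψx, hψz, sub_self]

theorem prod_linFactor {n i j : ℕ} (hij : i ≤ j) :
    ∏ l ∈ Finset.Icc i j, linFactor n i l =
      (∏ l ∈ Finset.Icc (i + 1) j, alC n i l) * xv n i := by
  rw [← Finset.insert_Icc_add_one_left_eq_Icc hij, Finset.prod_insert (by simp), mul_comm]
  congr 1
  · refine Finset.prod_congr rfl fun l hl => ?_
    have := Finset.mem_Icc.1 hl
    rw [linFactor, if_neg (by omega)]
  · rw [linFactor, if_pos rfl]

/-- After specialising `x_1, …, x_r`, the generator `f_{r+1,h(r+1)}` is a positive multiple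
of a product of linear forms. -/
theorem IsSpecialization.exists_map_fCij {n : ℕ} {h : ℕ → ℕ}
    (hh1 : ∀ i ∈ Finset.Icc 1 n, i ≤ h i ∧ h i ≤ 2 * n + 1 - i)
    {r : ℕ} {φ : MvPolynomial (Fin n) ℝ →ₐ[ℝ] MvPolynomial (Fin n) ℝ}
    (hφ : IsSpecialization n h r φ) (hr : r < n) :
    ∃ m : ℕ, φ (fCij n (r + 1) (h (r + 1))) =
      (m + 1) * φ (∏ l ∈ Finset.Icc (r + 1) (h (r + 1)), linFactor n (r + 1) l) := by
  obtain ⟨ha, hb⟩ := hh1 (r + 1) (by simp; omega)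
  rw [prod_linFactor ha]
  set D := φ ((∏ l ∈ Finset.Icc (r + 1 + 1) (h (r + 1)), alC n (r + 1) l) * xv n (r + 1)) with hD
  have hterm : ∀ k ∈ Finset.Icc 1 r,
      φ ((∏ l ∈ Finset.Icc (r + 1 + 1) (h (r + 1)), alC n k l) * xv n k) = 0 ∨
      φ ((∏ l ∈ Finset.Icc (r + 1 + 1) (h (r + 1)), alC n k l) * xv n k) = D := by
    intro k hk
    obtain ⟨hk1, hk2⟩ := Finset.mem_Icc.1 hk
    rcases hφ.2 k hk2 with h0 | ⟨t, h1, h2, h3, h4⟩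
    · exact Or.inl (by rw [map_mul, h0, mul_zero])
    have hal : ∀ l ∈ Finset.Icc (r + 1 + 1) (h (r + 1)), φ (alC n k l) = yv n t - yv n l := by
      intro l hl
      obtain ⟨hl1, hl2⟩ := Finset.mem_Icc.1 hl
      rw [alC_eq_sub n k l hk1 (by omega) (by omega), map_sub, h4,
        hφ.map_yv (by omega) (by omega)]
    by_cases ht : t = r + 1
    · right
      have hy : yv n t = xv n (r + 1) := by rw [ht, yv, if_pos (by omega)]
      rw [hD, map_mul, map_mul, map_prod, map_prod, h4, hφ.1 (r + 1) (by omega), hy]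
      congr 1
      refine Finset.prod_congr rfl fun l hl => ?_
      obtain ⟨hl1, hl2⟩ := Finset.mem_Icc.1 hl
      rw [hal l hl, alC_eq_sub n (r + 1) l (by omega) (by omega) (by omega), map_sub,
        hφ.map_yv (by omega) (by omega), hφ.1 (r + 1) (by omega), hy]
    · left
      have htm : t ∈ Finset.Icc (r + 1 + 1) (h (r + 1)) := by
        have := h3 hr
        simp
        omega
      rw [map_mul, map_prod, Finset.prod_eq_zero htm, zero_mul]
      rw [hal t htm, sub_self]
  have hsum : ∀ s ⊆ Finset.Icc 1 r, ∃ m : ℕ,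
      ∑ k ∈ s, φ ((∏ l ∈ Finset.Icc (r + 1 + 1) (h (r + 1)), alC n k l) * xv n k) = m * D := by
    intro s
    induction s using Finset.induction_on with
    | empty => exact fun _ => ⟨0, by simp⟩
    | insert k s hks ih =>
      intro hs
      obtain ⟨m, hm⟩ := ih ((Finset.subset_insert k s).trans hs)
      rw [Finset.sum_insert hks, hm]
      rcases hterm k (hs (Finset.mem_insert_self k s)) with h0 | h0
      · exact ⟨m, by rw [h0, zero_add]⟩
      · exact ⟨m + 1, by rw [h0]; push_cast; ring⟩
  obtain ⟨m, hm⟩ := hsum _ subset_rfl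
  refine ⟨m, ?_⟩
  rw [fCij, map_sum, Finset.sum_Icc_succ_top (by omega), hm]
  ring

/-- The generators `f_{r+1,h(r+1)}, …, f_{n,h(n)}`. -/
def generators (n : ℕ) (h : ℕ → ℕ) (r : ℕ) : List (MvPolynomial (Fin n) ℝ) :=
  (List.range' (r + 1) (n - r)).map fun i => fCij n i (h i)

theorem generators_self (n : ℕ) (h : ℕ → ℕ) : generators n h n = [] := by
  simp [generators]

theorem generators_of_lt {n r : ℕ} (h : ℕ → ℕ) (hr : r < n) :
    generators n h r = fCij n (r + 1) (h (r + 1)) :: generators n h (r + 1) := by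
  unfold generators
  rw [show n - r = (n - (r + 1)) + 1 by omega, List.range'_succ, List.map_cons]

namespace IsSpecialization

variable {n : ℕ} {h : ℕ → ℕ} {r : ℕ} {φ : MvPolynomial (Fin n) ℝ →ₐ[ℝ] MvPolynomial (Fin n) ℝ}

theorem regular_of_map_ne_zero {p : MvPolynomial (Fin n) ℝ} (hp : φ p ≠ 0)
    (u : MvPolynomial (Fin n) ℝ) (hu : p * u ∈ RingHom.ker φ) : u ∈ RingHom.ker φ := by
  rw [RingHom.mem_ker, map_mul] at hu
  exact (mul_eq_zero.1 hu).resolve_left hp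

theorem map_linFactor_ne_zero (hh1 : ∀ i ∈ Finset.Icc 1 n, i ≤ h i ∧ h i ≤ 2 * n + 1 - i)
    (hφ : IsSpecialization n h r φ) (hr : r < n) {j : ℕ}
    (hj : j ∈ Finset.Icc (r + 1) (h (r + 1))) : φ (linFactor n (r + 1) j) ≠ 0 := by
  obtain ⟨hj1, hj2⟩ := Finset.mem_Icc.1 hj
  obtain ⟨-, hb⟩ := hh1 (r + 1) (by simp; omega)
  rw [hφ.map_linFactor hr hj1 (by omega)]
  exact linFactor_ne_zero (by omega) (by omega) hj1 (by omega)

theorem ker_sup_span_fCij (hh1 : ∀ i ∈ Finset.Icc 1 n, i ≤ h i ∧ h i ≤ 2 * n + 1 - i)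
    (hφ : IsSpecialization n h r φ) (hr : r < n) :
    RingHom.ker φ ⊔ Ideal.span {fCij n (r + 1) (h (r + 1))} = RingHom.ker φ ⊔
      Ideal.span {∏ l ∈ Finset.Icc (r + 1) (h (r + 1)), linFactor n (r + 1) l} := by
  obtain ⟨m, hm⟩ := hφ.exists_map_fCij hh1 hr
  have hm0 : (m + 1 : ℝ) ≠ 0 := by positivity
  apply le_antisymm
  · refine sup_le le_sup_left ?_
    rw [Ideal.span_singleton_le_iff_mem, Ideal.mem_sup_span]
    refine ⟨m + 1, ?_⟩
    rw [RingHom.mem_ker, map_sub, hm, map_mul, map_add, map_natCast, map_one]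
    ring
  · refine sup_le le_sup_left ?_
    rw [Ideal.span_singleton_le_iff_mem, Ideal.mem_sup_span]
    refine ⟨C (m + 1 : ℝ)⁻¹, ?_⟩
    have hC : ((m : MvPolynomial (Fin n) ℝ) + 1) * C (m + 1 : ℝ)⁻¹ = 1 := by
      have : ((m : MvPolynomial (Fin n) ℝ) + 1) = C (m + 1 : ℝ) := by simp
      rw [this, ← C_mul, mul_inv_cancel₀ hm0, C_1]
    rw [RingHom.mem_ker, map_sub, map_mul, hm, ← algebraMap_eq, AlgHom.commutes, algebraMap_eq,
      mul_right_comm, hC, one_mul, sub_self]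

theorem weaklyRegularMod_generators
    (hh1 : ∀ i ∈ Finset.Icc 1 n, i ≤ h i ∧ h i ≤ 2 * n + 1 - i)
    (hh2 : ∀ i ∈ Finset.Icc 1 (n - 1), h i ≠ 2 * n + 1 - i → h i ≤ h (i + 1))
    (hh3 : ∀ i ∈ Finset.Icc 1 (n - 1), h i = 2 * n + 1 - i → h (i + 1) = 2 * n + 1 - (i + 1))
    (hrn : r ≤ n) (hφ : IsSpecialization n h r φ) :
    WeaklyRegularMod (RingHom.ker φ) (generators n h r) := by
  induction hrn using Nat.decreasingInduction generalizing φ with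
  | self => rw [generators_self]; trivial
  | of_succ r hr ih =>
    rw [generators_of_lt h hr]
    refine ⟨regular_of_map_ne_zero ?_, ?_⟩
    · obtain ⟨m, hm⟩ := hφ.exists_map_fCij hh1 hr
      rw [hm, map_prod]
      refine mul_ne_zero (by exact_mod_cast Nat.succ_ne_zero m) (Finset.prod_ne_zero_iff.2 ?_)
      exact fun j hj => hφ.map_linFactor_ne_zero hh1 hr hj
    · rw [hφ.ker_sup_span_fCij hh1 hr]
      refine WeaklyRegularMod.prod _ _
        (fun j hj => regular_of_map_ne_zero (hφ.map_linFactor_ne_zero hh1 hr hj))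
        (fun j hj => ?_)
      obtain ⟨φ', hφ', hker⟩ := hφ.exists_succ hh1 hh2 hh3 hr hj
      rw [← hker]
      exact ih hφ'

theorem coeff_eq_zero_of_sum_mem
    (hh1 : ∀ i ∈ Finset.Icc 1 n, i ≤ h i ∧ h i ≤ 2 * n + 1 - i)
    (hh2 : ∀ i ∈ Finset.Icc 1 (n - 1), h i ≠ 2 * n + 1 - i → h i ≤ h (i + 1))
    (hh3 : ∀ i ∈ Finset.Icc 1 (n - 1), h i = 2 * n + 1 - i → h (i + 1) = 2 * n + 1 - (i + 1))
    {ι : Type*} (m : ι → ℕ → ℕ) (c : ι → ℝ) (hrn : r ≤ n) (hφ : IsSpecialization n h r φ)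
    (T : Finset ι) (hm : ∀ p ∈ T, ∀ i ∈ Finset.Icc (r + 1) n, m p i ∈ Finset.Icc i (h i))
    (hinj : ∀ p ∈ T, ∀ q ∈ T, (∀ i ∈ Finset.Icc (r + 1) n, m p i = m q i) → p = q)
    (hmem : ∑ p ∈ T, C (c p) *
      ∏ i ∈ Finset.Icc (r + 1) n, ∏ j ∈ Finset.Icc (m p i + 1) (h i), alC n i j ∈
        RingHom.ker φ ⊔ Ideal.ofList (generators n h r)) :
    ∀ p ∈ T, c p = 0 := by
  induction hrn using Nat.decreasingInduction generalizing φ T with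
  | self =>
    intro p hp
    have hT : T = {p} :=
      Finset.eq_singleton_iff_unique_mem.2 ⟨hp, fun q hq => hinj q hq p hp (by simp)⟩
    rw [hT, generators_self] at hmem
    simpa [RingHom.mem_ker, ← algebraMap_eq, AlgHom.commutes] using hmem
  | of_succ r hr ih =>
    set P : ι → MvPolynomial (Fin n) ℝ := fun p =>
      ∏ i ∈ Finset.Icc (r + 1 + 1) n, ∏ j ∈ Finset.Icc (m p i + 1) (h i), alC n i j with hP
    set Q : ℕ → MvPolynomial (Fin n) ℝ := fun j =>
      ∑ p ∈ T with m p (r + 1) = j, C (c p) * P p with hQ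
    set L := RingHom.ker φ ⊔ Ideal.ofList (generators n h (r + 1)) with hL
    have hr1 : r + 1 ∈ Finset.Icc (r + 1) n := by simp; omega
    have hsubset : Finset.Icc (r + 1 + 1) n ⊆ Finset.Icc (r + 1) n :=
      Finset.Icc_subset_Icc_left (Nat.le_succ _)
    have hcoeff : ∀ j ∈ Finset.Icc (r + 1) (h (r + 1)),
        Q j ∈ L ⊔ Ideal.span {linFactor n (r + 1) j} →
        ∀ p ∈ T, m p (r + 1) = j → c p = 0 := by
      intro j hj hQj p hp hpj
      obtain ⟨φ', hφ', hker⟩ := hφ.exists_succ hh1 hh2 hh3 hr hj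
      refine ih hφ' (T.filter fun p => m p (r + 1) = j) ?_ ?_ ?_ p
        (Finset.mem_filter.2 ⟨hp, hpj⟩)
      · exact fun q hq i hi => hm q (Finset.mem_filter.1 hq).1 i (hsubset hi)
      · intro q hq q' hq' hqq
        obtain ⟨hq1, hq2⟩ := Finset.mem_filter.1 hq
        obtain ⟨hq1', hq2'⟩ := Finset.mem_filter.1 hq'
        refine hinj q hq1 q' hq1' fun i hi => ?_
        by_cases hir : i = r + 1
        · rw [hir, hq2, hq2']
        · exact hqq i (by have := Finset.mem_Icc.1 hi; simp; omega)
      · rwa [hker, sup_right_comm]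
    have hreg : ∀ j ∈ Finset.Icc (r + 1) (h (r + 1)), ∀ u,
        linFactor n (r + 1) j * u ∈ L → u ∈ L := by
      intro j hj
      obtain ⟨φ', hφ', hker⟩ := hφ.exists_succ hh1 hh2 hh3 hr hj
      refine WeaklyRegularMod.regular_sup_ofList
        (regular_of_map_ne_zero (hφ.map_linFactor_ne_zero hh1 hr hj)) ?_
      rw [← hker]
      exact hφ'.weaklyRegularMod_generators hh1 hh2 hh3 hr
    have hsum : ∑ p ∈ T, C (c p) *
        ∏ i ∈ Finset.Icc (r + 1) n, ∏ j ∈ Finset.Icc (m p i + 1) (h i), alC n i j =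
        ∑ j ∈ Finset.Icc (r + 1) (h (r + 1)),
          (∏ l ∈ Finset.Icc (j + 1) (h (r + 1)), linFactor n (r + 1) l) * Q j := by
      rw [← Finset.sum_fiberwise_of_maps_to (fun p hp => hm p hp (r + 1) hr1)]
      refine Finset.sum_congr rfl fun j hj => ?_
      rw [hQ, Finset.mul_sum]
      refine Finset.sum_congr rfl fun p hp => ?_
      have hpj := (Finset.mem_filter.1 hp).2
      have hj1 := (Finset.mem_Icc.1 hj).1
      rw [← Finset.insert_Icc_add_one_left_eq_Icc (show r + 1 ≤ n from hr),
        Finset.prod_insert (by simp), hpj, mul_left_comm]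
      congr 1
      refine Finset.prod_congr rfl fun l hl => ?_
      have := (Finset.mem_Icc.1 hl).1
      rw [linFactor, if_neg (by omega)]
    rw [hsum, generators_of_lt h hr, Ideal.ofList_cons, ← sup_assoc,
      hφ.ker_sup_span_fCij hh1 hr, sup_right_comm] at hmem
    have hQ0 := eq_zero_of_sum_prod_mul_mem (L := L) (linFactor n (r + 1)) Q _ _ hreg
      (fun j hj hQj => Finset.sum_eq_zero fun p hp => by
        obtain ⟨hp1, hp2⟩ := Finset.mem_filter.1 hp
        rw [hcoeff j hj hQj p hp1 hp2, C_0, zero_mul]) hmem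
    intro p hp
    have hpm := hm p hp (r + 1) hr1
    refine hcoeff _ hpm ?_ p hp rfl
    rw [hQ0 _ hpm]
    exact Ideal.zero_mem _

end IsSpecialization

theorem isSpecialization_id (n : ℕ) (h : ℕ → ℕ) :
    IsSpecialization n h 0 (AlgHom.id ℝ (MvPolynomial (Fin n) ℝ)) := by
  refine ⟨fun _ _ => rfl, fun k hk => Or.inl ?_⟩
  rw [AlgHom.id_apply, xv, dif_neg (by omega)]

theorem ofList_generators (n : ℕ) (h : ℕ → ℕ) : Ideal.ofList (generators n h 0) = ICh n h := by
  unfold Ideal.ofList ICh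
  congr 1
  ext p
  simp only [generators, List.mem_map, List.mem_range'_1, Set.mem_ofPred_eq, Set.mem_image,
    Set.mem_Icc]
  exact exists_congr fun i => and_congr_left fun _ => by omega

/-- **Theorem 7.1 (type C).** For a Hessenberg function `h` of type `C_n`, the classes
`P_{h'} = ∏_{i=1}^{n} ∏_{j=h'(i)+1}^{h(i)} α^{C}_{i,j}` in `R^{C}_h ≅ H^*(Hess(N,h))` —
which are, up to nonzero scalars, the Poincaré duals `[Hess(N,h')]` of the smaller regular
nilpotent Hessenberg varieties — are linearly independent over ℝ. -/
theorem stmt_17 (n : ℕ) (hn : 1 ≤ n) (h : ℕ → ℕ)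
    (hh1 : ∀ i ∈ Finset.Icc 1 n, i ≤ h i ∧ h i ≤ 2 * n + 1 - i)
    (hh2 : ∀ i ∈ Finset.Icc 1 (n - 1), h i ≠ 2 * n + 1 - i → h i ≤ h (i + 1))
    (hh3 : ∀ i ∈ Finset.Icc 1 (n - 1), h i = 2 * n + 1 - i → h (i + 1) = 2 * n + 1 - (i + 1)) :
    LinearIndependent ℝ (fun h' : HessSubC n h =>
      Ideal.Quotient.mk (ICh n h)
        (∏ i ∈ Finset.Icc 1 n, ∏ j ∈ Finset.Icc (h'.1 i + 1) (h i), alC n i j)) := by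
  rw [linearIndependent_iff']
  intro T c hc
  refine (isSpecialization_id n h).coeff_eq_zero_of_sum_mem hh1 hh2 hh3 (fun p => p.1) c
    (Nat.zero_le n) T ?_ ?_ ?_
  · intro p _ i hi
    exact Finset.mem_Icc.2 ⟨(p.2.1 i hi).1, p.2.2.2.2.2 i hi⟩
  · intro p _ q _ hpq
    refine Subtype.ext (funext fun i => ?_)
    by_cases hi : i ∈ Finset.Icc 1 n
    · exact hpq i hi
    · rw [p.2.2.2.2.1 i hi, q.2.2.2.2.1 i hi]
  · rw [ofList_generators]
    refine Ideal.mem_sup_right (Ideal.Quotient.eq_zero_iff_mem.1 ?_)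
    rw [map_sum, ← hc]
    refine Finset.sum_congr rfl fun p _ => ?_
    rw [← smul_eq_C_mul]
    rfl
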